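/- arXiv:2510.05474 — 9 statements merged into one kernel-verified Lean document; each statement's English description precedes it below -/
import Mathlib

section
/- Let m ≥ 1 and 1 ≤ k ≤ m be integers and let p ∈ (0,1). Then C(m,k)·(1−p)^{m−k}·p^k / (∑_{i=k}^{m} C(m,i)·(1−p)^{m−i}·p^i) ≥ 1 − p(m−k)/((1−p)k). Equivalently, for a binomial random variable B(m,p) with m trials and success probability p, Pr[B(m,p) = k | B(m,p) ≥ k] ≥ 1 − p(m−k)/((1−p)k). -/
/-- Consecutive binomial weights beyond index `k` decay at least by the factor
`p(m−k)/((1−p)k)`. -/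
theorem binomial_weight_succ_le {m k i : ℕ} (hk : 1 ≤ k) (hki : k ≤ i) (him : i < m)
    {p : ℝ} (hp0 : 0 < p) (hp1 : p < 1) :
    (Nat.choose m (i + 1) : ℝ) * (1 - p) ^ (m - (i + 1)) * p ^ (i + 1) ≤
      p * ((m : ℝ) - (k : ℝ)) / ((1 - p) * (k : ℝ)) *
        ((Nat.choose m i : ℝ) * (1 - p) ^ (m - i) * p ^ i) := by
  have hq : 0 < 1 - p := sub_pos.mpr hp1
  have hk' : (0 : ℝ) < k := by exact_mod_cast hk
  have hchoose : m.choose (i + 1) * k ≤ m.choose i * (m - k) :=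
    calc m.choose (i + 1) * k ≤ m.choose (i + 1) * (i + 1) := by gcongr; omega
      _ = m.choose i * (m - i) := Nat.choose_succ_right_eq m i
      _ ≤ m.choose i * (m - k) := by gcongr
  have hchoose' : (m.choose (i + 1) : ℝ) * k ≤ m.choose i * ((m : ℝ) - k) := by
    rw [← Nat.cast_sub (hki.trans him.le)]
    exact_mod_cast hchoose
  obtain ⟨d, rfl⟩ := Nat.exists_eq_add_of_lt him
  have h₁ : i + d + 1 - (i + 1) = d := by omega
  have h₂ : i + d + 1 - i = d + 1 := by omega
  rw [h₁, h₂, div_mul_eq_mul_div, le_div_iff₀ (by positivity)]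
  have hpos : 0 ≤ (1 - p) ^ (d + 1) * p ^ (i + 1) := by positivity
  linear_combination mul_le_mul_of_nonneg_right hchoose' hpos

/-- For integers `1 ≤ k ≤ m` and `p ∈ (0,1)`:
`Pr[B(m,p) = k | B(m,p) ≥ k] ≥ 1 − p(m−k)/((1−p)k)`, written out via binomial
probabilities. -/
theorem binomial_conditional_bound (m k : ℕ) (hm : 1 ≤ m) (hk : 1 ≤ k) (hkm : k ≤ m)
    (p : ℝ) (hp0 : 0 < p) (hp1 : p < 1) :
    ((Nat.choose m k : ℝ) * (1 - p) ^ (m - k) * p ^ k) /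
        (∑ i ∈ Finset.Icc k m, (Nat.choose m i : ℝ) * (1 - p) ^ (m - i) * p ^ i)
      ≥ 1 - p * ((m : ℝ) - (k : ℝ)) / ((1 - p) * (k : ℝ)) := by
  have hq : 0 < 1 - p := sub_pos.mpr hp1
  have hk' : (0 : ℝ) < k := by exact_mod_cast hk
  have hmk : (0 : ℝ) ≤ (m : ℝ) - k := sub_nonneg.mpr (by exact_mod_cast hkm)
  set r : ℝ := p * ((m : ℝ) - (k : ℝ)) / ((1 - p) * (k : ℝ))
  have hr0 : 0 ≤ r := by positivity
  let a : ℕ → ℝ := fun i => (Nat.choose m i : ℝ) * (1 - p) ^ (m - i) * p ^ i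
  have ha (i : ℕ) : 0 ≤ a i := by positivity
  have hak : 0 < a k := by
    have : 0 < m.choose k := Nat.choose_pos hkm
    positivity
  change a k / (∑ i ∈ Finset.Icc k m, a i) ≥ 1 - r
  have hS : 0 < ∑ i ∈ Finset.Icc k m, a i :=
    Finset.sum_pos' (fun i _ => ha i) ⟨k, Finset.left_mem_Icc.mpr hkm, hak⟩
  have hsplit : ∑ i ∈ Finset.Icc k m, a i = a k + ∑ i ∈ Finset.Ico k m, a (i + 1) := by
    rw [← Finset.Ico_add_one_right_eq_Icc, Finset.sum_eq_sum_Ico_succ_bot (by omega),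
      Finset.sum_Ico_add']
  have htail : ∑ i ∈ Finset.Ico k m, a (i + 1) ≤ r * ∑ i ∈ Finset.Icc k m, a i :=
    calc ∑ i ∈ Finset.Ico k m, a (i + 1) ≤ ∑ i ∈ Finset.Ico k m, r * a i :=
          Finset.sum_le_sum fun i hi =>
            binomial_weight_succ_le hk (Finset.mem_Ico.mp hi).1 (Finset.mem_Ico.mp hi).2 hp0 hp1
      _ = r * ∑ i ∈ Finset.Ico k m, a i := (Finset.mul_sum _ _ _).symm
      _ ≤ r * ∑ i ∈ Finset.Icc k m, a i :=
          mul_le_mul_of_nonneg_left (Finset.sum_le_sum_of_subset_of_nonneg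
            Finset.Ico_subset_Icc_self fun i _ _ => ha i) hr0
  rw [ge_iff_le, le_div_iff₀ hS]
  linarith
end

section
/- Let m ≥ 2 be an integer and p ∈ (0,1). Define g(k) = (p(m−k)/(1−p))·∑_{i=k}^{m} C(m,i)(1−p)^{m−i}p^i − k·∑_{i=k+1}^{m} C(m,i)(1−p)^{m−i}p^i. Then g(k) ≥ g(k+1) for all 1 ≤ k ≤ m−2, g(m−1) = p^m/(1−p), and consequently g(k) ≥ 0 for all 1 ≤ k ≤ m−1. -/
/-- The `i`-th term of the binomial distribution with parameters `m` and `p`. -/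
def binomialTerm (m : ℕ) (p : ℝ) (i : ℕ) : ℝ :=
  (Nat.choose m i : ℝ) * (1 - p) ^ (m - i) * p ^ i

/-- The ratio of consecutive binomial terms, in cross-multiplied form. -/
lemma binomialTerm_succ_mul {m k : ℕ} (hk : k < m) (p : ℝ) :
    binomialTerm m p (k + 1) * (k + 1) * (1 - p) = p * (m - k) * binomialTerm m p k := by
  obtain ⟨d, rfl⟩ := Nat.exists_eq_add_of_lt hk
  have h : ((k + d + 1).choose (k + 1) : ℝ) * (k + 1) = (k + d + 1).choose k * (d + 1) := by
    have h := Nat.choose_succ_right_eq (k + d + 1) k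
    rw [show k + d + 1 - k = d + 1 by omega] at h
    exact_mod_cast h
  unfold binomialTerm
  rw [show k + d + 1 - (k + 1) = d by omega, show k + d + 1 - k = d + 1 by omega]
  push_cast
  linear_combination (1 - p) ^ (d + 1) * p ^ (k + 1) * h

/-- The upper tail of the binomial distribution is nonnegative. -/
lemma binomialTail_nonneg (m k : ℕ) {p : ℝ} (hp0 : 0 ≤ p) (hp1 : p ≤ 1) :
    0 ≤ ∑ i ∈ Finset.Icc k m, binomialTerm m p i := by
  have hq : 0 ≤ 1 - p := sub_nonneg.2 hp1
  exact Finset.sum_nonneg fun i _ => by unfold binomialTerm; positivity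

/-- The weighted tail difference drops by a multiple of the upper tail at each step. -/
lemma binomialTail_weighted_sub_succ {m k : ℕ} (hk : k < m) {p : ℝ} (hp1 : p < 1) :
    (p * ((m : ℝ) - k) / (1 - p) * (∑ i ∈ Finset.Icc k m, binomialTerm m p i)
        - k * ∑ i ∈ Finset.Icc (k + 1) m, binomialTerm m p i)
      - (p * ((m : ℝ) - (k + 1 : ℕ)) / (1 - p) *
          (∑ i ∈ Finset.Icc (k + 1) m, binomialTerm m p i)
        - (k + 1 : ℕ) * ∑ i ∈ Finset.Icc (k + 1 + 1) m, binomialTerm m p i)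
      = (∑ i ∈ Finset.Icc (k + 1) m, binomialTerm m p i) / (1 - p) := by
  have hq : 1 - p ≠ 0 := (sub_pos.2 hp1).ne'
  have hratio := binomialTerm_succ_mul hk p
  rw [← Finset.add_sum_Ioc_eq_sum_Icc hk.le, ← Finset.Icc_add_one_left_eq_Ioc,
    ← Finset.add_sum_Ioc_eq_sum_Icc (show k + 1 ≤ m from hk), ← Finset.Icc_add_one_left_eq_Ioc]
  push_cast
  field_simp
  linear_combination -hratio


/-- For `m ≥ 2`, `p ∈ (0,1)` and
`g(k) = (p(m−k)/(1−p))·∑_{i=k}^{m} C(m,i)(1−p)^{m−i}p^i − k·∑_{i=k+1}^{m} C(m,i)(1−p)^{m−i}p^i`,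
we have `g(k) ≥ g(k+1)` for `1 ≤ k ≤ m−2`, `g(m−1) = p^m/(1−p)`, and `g(k) ≥ 0`
for all `1 ≤ k ≤ m−1`. -/
theorem g_decreasing_and_nonneg (m : ℕ) (hm : 2 ≤ m) (p : ℝ) (hp0 : 0 < p) (hp1 : p < 1)
    (g : ℕ → ℝ)
    (hg : ∀ k : ℕ, g k =
      p * ((m : ℝ) - (k : ℝ)) / (1 - p) *
          (∑ i ∈ Finset.Icc k m, (Nat.choose m i : ℝ) * (1 - p) ^ (m - i) * p ^ i)
        - (k : ℝ) *
          (∑ i ∈ Finset.Icc (k + 1) m, (Nat.choose m i : ℝ) * (1 - p) ^ (m - i) * p ^ i)) :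
    (∀ k : ℕ, 1 ≤ k → k ≤ m - 2 → g k ≥ g (k + 1)) ∧
    g (m - 1) = p ^ m / (1 - p) ∧
    (∀ k : ℕ, 1 ≤ k → k ≤ m - 1 → g k ≥ 0) := by
  have hstep : ∀ k < m, g k - g (k + 1) =
      (∑ i ∈ Finset.Icc (k + 1) m, binomialTerm m p i) / (1 - p) := fun k hk => by
    rw [hg k, hg (k + 1)]
    exact binomialTail_weighted_sub_succ hk hp1
  have hanti : ∀ k < m, g (k + 1) ≤ g k := fun k hk => by
    rw [← sub_nonneg, hstep k hk]
    exact div_nonneg (binomialTail_nonneg m (k + 1) hp0.le hp1.le) (sub_pos.2 hp1).le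
  have hlast : g m = 0 := by simp [hg]
  refine ⟨fun k _ hk => hanti k (by omega), ?_, fun k _ hk => ?_⟩
  · have h := hstep (m - 1) (by omega)
    rw [Nat.sub_add_cancel (by omega : 1 ≤ m), hlast] at h
    simpa [binomialTerm] using h
  · have hle : k ≤ m := by omega
    exact Nat.decreasingInduction (motive := fun j _ => 0 ≤ g j)
      (fun j hj ih => ih.trans (hanti j hj)) hlast.ge hle
end

section
/- Let m ≥ 2 be an integer, p ∈ (0,1), and a, b real numbers with b ≥ a. For integers 0 ≤ k ≤ m−1 define f(k) = a − (b−a)·(∑_{z=k+1}^{m} C(m,z)(1−p)^z p^{m−z}) / ((1−p)^k · p^{m−k} · (m−k) · C(m,k)). Then f(k) ≥ f(k−1) for every 1 ≤ k ≤ m−1; that is, f is nondecreasing in k. -/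
/-- Consecutive binomial weights satisfy `(z + 1) p c (z + 1) = (m - z) q c z`. -/
lemma binomial_weight_succ (m z : ℕ) (hz : z < m) (p q : ℝ) :
    ((m.choose (z + 1) : ℝ) * q ^ (z + 1) * p ^ (m - (z + 1))) * ((z : ℝ) + 1) * p =
      ((m : ℝ) - z) * ((m.choose z : ℝ) * q ^ z * p ^ (m - z)) * q := by
  have h : (m.choose (z + 1) : ℝ) * ((z : ℝ) + 1) = m.choose z * ((m : ℝ) - z) := by
    rw [← Nat.cast_sub hz.le]
    exact_mod_cast Nat.choose_succ_right_eq m z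
  have e : m - z = m - (z + 1) + 1 := by omega
  rw [e, pow_succ, pow_succ]
  linear_combination q ^ z * q * p ^ (m - (z + 1)) * p * h

/-- Comparison of two consecutive upper binomial tails. -/
lemma binomial_tail_le (m k : ℕ) (p q : ℝ) (hp : 0 ≤ p) (hq : 0 ≤ q) (hk : k ≤ m) :
    (∑ z ∈ Finset.Icc (k + 1) m, (m.choose z : ℝ) * q ^ z * p ^ (m - z)) * (k * p) ≤
      (∑ z ∈ Finset.Icc k m, (m.choose z : ℝ) * q ^ z * p ^ (m - z)) * (((m : ℝ) - k) * q) := by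
  have hkm : (0 : ℝ) ≤ (m : ℝ) - k := sub_nonneg.2 (by exact_mod_cast hk)
  have hc : ∀ z, 0 ≤ (m.choose z : ℝ) * q ^ z * p ^ (m - z) := fun z => by positivity
  have hshift : Finset.Icc (k + 1) m = Finset.Ico (k + 1) (m + 1) := by ext; simp
  rw [hshift, ← Finset.sum_Ico_add']
  calc _ ≤ (∑ z ∈ Finset.Ico k m, (m.choose z : ℝ) * q ^ z * p ^ (m - z)) *
          (((m : ℝ) - k) * q) := by
        rw [Finset.sum_mul, Finset.sum_mul]
        refine Finset.sum_le_sum fun z hz => ?_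
        obtain ⟨hkz, hzm⟩ := Finset.mem_Ico.1 hz
        have hkz' : (k : ℝ) ≤ z := by exact_mod_cast hkz
        have h1 := mul_le_mul_of_nonneg_left (by linarith : (k : ℝ) ≤ z + 1)
          (mul_nonneg (hc (z + 1)) hp)
        have h2 := mul_le_mul_of_nonneg_left (by linarith : (m : ℝ) - z ≤ m - k)
          (mul_nonneg (hc z) hq)
        linarith [binomial_weight_succ m z hzm p q]
    _ ≤ _ := by
        refine mul_le_mul_of_nonneg_right ?_ (mul_nonneg hkm hq)
        exact Finset.sum_le_sum_of_subset_of_nonneg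
          Finset.Ico_subset_Icc_self fun z _ _ => hc z

/-- For `m ≥ 2`, `p ∈ (0,1)`, `b ≥ a`, and
`f(k) = a − (b−a)·(∑_{z=k+1}^{m} C(m,z)(1−p)^z p^{m−z}) / ((1−p)^k p^{m−k}(m−k)C(m,k))`
defined for `0 ≤ k ≤ m−1`, the function `f` is nondecreasing:
`f(k) ≥ f(k−1)` for every `1 ≤ k ≤ m−1`. -/
theorem f_monotone (m : ℕ) (hm : 2 ≤ m) (p : ℝ) (hp0 : 0 < p) (hp1 : p < 1)
    (a b : ℝ) (hab : a ≤ b)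
    (f : ℕ → ℝ)
    (hf : ∀ k : ℕ, k ≤ m - 1 → f k =
      a - (b - a) *
        (∑ z ∈ Finset.Icc (k + 1) m, (Nat.choose m z : ℝ) * (1 - p) ^ z * p ^ (m - z)) /
        ((1 - p) ^ k * p ^ (m - k) * ((m : ℝ) - (k : ℝ)) * (Nat.choose m k : ℝ))) :
    ∀ k : ℕ, 1 ≤ k → k ≤ m - 1 → f k ≥ f (k - 1) := by
  intro k hk1 hkm
  obtain ⟨j, rfl⟩ : ∃ j, k = j + 1 := ⟨k - 1, by omega⟩
  rw [Nat.add_sub_cancel, hf _ hkm, hf j (by omega), ge_iff_le, mul_div_assoc, mul_div_assoc]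
  have hq : 0 < 1 - p := by linarith
  refine sub_le_sub_left (mul_le_mul_of_nonneg_left ?_ (sub_nonneg.2 hab)) a
  have hpos : ∀ i : ℕ, i < m →
      0 < (1 - p) ^ i * p ^ (m - i) * ((m : ℝ) - (i : ℝ)) * (Nat.choose m i : ℝ) := by
    intro i hi
    have h1 : (0 : ℝ) < (m : ℝ) - i := sub_pos.2 (by exact_mod_cast hi)
    have h2 : (0 : ℝ) < m.choose i := by exact_mod_cast Nat.choose_pos hi.le
    positivity
  rw [div_le_div_iff₀ (hpos _ (by omega)) (hpos _ (by omega))]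
  refine le_of_mul_le_mul_right ?_ hq
  have hrec := binomial_weight_succ m j (by omega) p (1 - p)
  have hw : 0 ≤ (m.choose (j + 1) : ℝ) * (1 - p) ^ (j + 1) * p ^ (m - (j + 1)) := by positivity
  have hT := mul_le_mul_of_nonneg_right
    (binomial_tail_le m (j + 1) p (1 - p) hp0.le hq.le (by omega)) hw
  set S := ∑ z ∈ Finset.Icc (j + 1 + 1) m, (m.choose z : ℝ) * (1 - p) ^ z * p ^ (m - z)
  set T := ∑ z ∈ Finset.Icc (j + 1) m, (m.choose z : ℝ) * (1 - p) ^ z * p ^ (m - z)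
  push_cast at hT ⊢
  linear_combination hT - S * hrec
end

section
/- Mechanism 1 (the first-axis mechanism) is Bayesian incentive compatible and individually rational: for all v, r ∈ {a,b}^m one has u(v,v) ≥ u(v,r) and u(v,v) ≥ 0; moreover u(v,v) = (b−a)·∑_{τ=0}^{k_v−1} π(a,τ). -/
/-!
The first-axis mechanism for `n` i.i.d. agents and `m` i.i.d. bi-valued items.
Valuations are modeled as `v : Fin m → Bool`, where `v j = true` means value `b`
for item `j` and `v j = false` means value `a`.
-/

noncomputable section

open Finset

/-- `kOf v` is the number of coordinates of the valuation `v` equal to the high value `b`. -/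
def kOf {m : ℕ} (v : Fin m → Bool) : ℕ := (Finset.univ.filter fun j => v j = true).card

/-- The virtual value `f(k)` of a low-value item when `k` items have the high value. -/
def fVal (m : ℕ) (a b p : ℝ) (k : ℕ) : ℝ :=
  a - (b - a) *
      (∑ z ∈ Finset.Icc (k + 1) m, (Nat.choose m z : ℝ) * (1 - p) ^ z * p ^ (m - z)) /
      ((1 - p) ^ k * p ^ (m - k) * ((m : ℝ) - (k : ℝ)) * (Nat.choose m k : ℝ))

open Classical in
/-- `kStar` is the least `k ∈ {0,…,m−1}` with `fVal m a b p k > 0`, and `m` if no such `k`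
exists. -/
def kStar (m : ℕ) (a b p : ℝ) : ℕ :=
  if h : ∃ k, k ≤ m - 1 ∧ 0 < fVal m a b p k then Nat.find h else m

/-- `Scum m p k = ∑_{z=0}^{k} C(m−1,z)(1−p)^z p^{m−1−z}`, i.e. `Pr[B(m−1,1−p) ≤ k]`. -/
def Scum (m : ℕ) (p : ℝ) (k : ℕ) : ℝ :=
  ∑ z ∈ Finset.range (k + 1), (Nat.choose (m - 1) z : ℝ) * (1 - p) ^ z * p ^ (m - 1 - z)

/-- `Sprev m p k = S_{k-1}`, with the convention `S_{−1} = 0`. -/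
def Sprev (m : ℕ) (p : ℝ) (k : ℕ) : ℝ :=
  if k = 0 then 0 else Scum m p (k - 1)

/-- Interim allocation probability `π(b)` for an item reported at the high value. -/
def piB (n : ℕ) (p : ℝ) : ℝ :=
  ∑ z ∈ Finset.range n,
    (1 / ((z : ℝ) + 1)) * (Nat.choose (n - 1) z : ℝ) * (1 - p) ^ z * p ^ (n - 1 - z)

/-- Interim allocation probability `π(a,k)` for an item reported at the low value when `k`
items are reported at the high value. -/
def piA (n m : ℕ) (a b p : ℝ) (k : ℕ) : ℝ :=
  if kStar m a b p ≤ k ∧ k ≤ m - 1 then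
    p ^ (n - 1) * (Scum m p k ^ n - Sprev m p k ^ n) /
      ((n : ℝ) * (Scum m p k - Sprev m p k))
  else 0

/-- Interim allocation probability for item `j` under report `r`. -/
def interim (n m : ℕ) (a b p : ℝ) (r : Fin m → Bool) (j : Fin m) : ℝ :=
  if r j then piB n p else piA n m a b p (kOf r)

/-- Interim payment under report `r`. -/
def pay (n m : ℕ) (a b p : ℝ) (r : Fin m → Bool) : ℝ :=
  (kOf r : ℝ) * b * piB n p + ((m : ℝ) - (kOf r : ℝ)) * a * piA n m a b p (kOf r)
    - (b - a) * ∑ τ ∈ Finset.range (kOf r), piA n m a b p τ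

/-- Interim utility of an agent with true valuation `v` reporting `r`. -/
def util (n m : ℕ) (a b p : ℝ) (v r : Fin m → Bool) : ℝ :=
  (∑ j : Fin m, (if v j then b else a) * interim n m a b p r j) - pay n m a b p r

lemma binomial_term_pos {m k : ℕ} {p : ℝ} (hp0 : 0 < p) (hp1 : p < 1) (hk : k ≤ m - 1) :
    0 < (Nat.choose (m - 1) k : ℝ) * (1 - p) ^ k * p ^ (m - 1 - k) := by
  have hq : 0 < 1 - p := by linarith
  have hc : (0 : ℝ) < Nat.choose (m - 1) k := by exact_mod_cast Nat.choose_pos hk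
  positivity

lemma binomial_term_nonneg (m k : ℕ) {p : ℝ} (hp0 : 0 < p) (hp1 : p < 1) :
    0 ≤ (Nat.choose (m - 1) k : ℝ) * (1 - p) ^ k * p ^ (m - 1 - k) := by
  have hq : 0 < 1 - p := by linarith
  positivity

lemma Scum_nonneg (m k : ℕ) {p : ℝ} (hp0 : 0 < p) (hp1 : p < 1) : 0 ≤ Scum m p k :=
  Finset.sum_nonneg fun z _ => binomial_term_nonneg m z hp0 hp1

lemma Scum_mono (m : ℕ) {p : ℝ} (hp0 : 0 < p) (hp1 : p < 1) : Monotone (Scum m p) := by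
  intro k l hkl
  refine Finset.sum_le_sum_of_subset_of_nonneg (Finset.range_subset_range.2 (by omega)) ?_
  exact fun z _ _ => binomial_term_nonneg m z hp0 hp1

lemma Scum_le_one {m k : ℕ} {p : ℝ} (hp0 : 0 < p) (hp1 : p < 1) (hk : k ≤ m - 1) :
    Scum m p k ≤ 1 := by
  refine (Scum_mono m hp0 hp1 hk).trans (le_of_eq ?_)
  have h := add_pow (1 - p) p (m - 1)
  rw [sub_add_cancel, one_pow] at h
  rw [h, Scum]
  exact Finset.sum_congr rfl fun z _ => by ring

lemma Sprev_nonneg (m k : ℕ) {p : ℝ} (hp0 : 0 < p) (hp1 : p < 1) : 0 ≤ Sprev m p k := by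
  unfold Sprev
  split_ifs
  exacts [le_rfl, Scum_nonneg _ _ hp0 hp1]

lemma Sprev_mono (m : ℕ) {p : ℝ} (hp0 : 0 < p) (hp1 : p < 1) : Monotone (Sprev m p) := by
  intro k l hkl
  rcases Nat.eq_zero_or_pos k with rfl | hk
  · simpa [Sprev] using Sprev_nonneg m l hp0 hp1
  · simp only [Sprev, hk.ne', (hk.trans_le hkl).ne', if_false]
    exact Scum_mono m hp0 hp1 (by omega)

lemma Sprev_lt_Scum {m k : ℕ} {p : ℝ} (hp0 : 0 < p) (hp1 : p < 1) (hk : k ≤ m - 1) :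
    Sprev m p k < Scum m p k := by
  have h := binomial_term_pos hp0 hp1 hk
  cases k with
  | zero => simpa [Sprev, Scum] using h
  | succ k =>
    rw [Scum, Finset.sum_range_succ]
    simp only [Sprev, Nat.succ_ne_zero, if_false, Nat.add_sub_cancel, Scum]
    linarith

/-- The difference quotient in `piA` written as a sum of products of nonnegative powers. -/
lemma piA_eq_geom_sum {n m k : ℕ} {a b p : ℝ} (hp0 : 0 < p) (hp1 : p < 1)
    (hk : kStar m a b p ≤ k) (hkm : k ≤ m - 1) :
    piA n m a b p k =
      p ^ (n - 1) * (∑ i ∈ range n, Scum m p k ^ i * Sprev m p k ^ (n - 1 - i)) / n := by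
  have hne : Scum m p k - Sprev m p k ≠ 0 := (sub_pos.2 (Sprev_lt_Scum hp0 hp1 hkm)).ne'
  rw [piA, if_pos ⟨hk, hkm⟩, ← geom_sum₂_mul, ← mul_assoc, mul_div_mul_right _ _ hne]

lemma piA_nonneg (n m : ℕ) (a b : ℝ) {p : ℝ} (hp0 : 0 < p) (hp1 : p < 1) (k : ℕ) :
    0 ≤ piA n m a b p k := by
  by_cases h : kStar m a b p ≤ k ∧ k ≤ m - 1
  · rw [piA_eq_geom_sum hp0 hp1 h.1 h.2]
    have hS := Scum_nonneg m k hp0 hp1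
    have hS' := Sprev_nonneg m k hp0 hp1
    positivity
  · rw [piA, if_neg h]

lemma piA_le_piA (n : ℕ) {m k l : ℕ} (a b : ℝ) {p : ℝ} (hp0 : 0 < p) (hp1 : p < 1)
    (hkl : k ≤ l) (hl : l ≤ m - 1) : piA n m a b p k ≤ piA n m a b p l := by
  by_cases h : kStar m a b p ≤ k
  · rw [piA_eq_geom_sum hp0 hp1 h (hkl.trans hl), piA_eq_geom_sum hp0 hp1 (h.trans hkl) hl]
    have hS := Scum_nonneg m k hp0 hp1
    have hSl := Scum_nonneg m l hp0 hp1
    have hS' := Sprev_nonneg m k hp0 hp1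
    have hmono := Scum_mono m hp0 hp1 hkl
    have hmono' := Sprev_mono m hp0 hp1 hkl
    gcongr
  · rw [piA, if_neg fun h' => h h'.1]
    exact piA_nonneg n m a b hp0 hp1 l

lemma pow_le_piB {n : ℕ} (hn : 1 ≤ n) {p : ℝ} (hp0 : 0 < p) (hp1 : p < 1) :
    p ^ (n - 1) ≤ piB n p := by
  have hq : 0 < 1 - p := by linarith
  have h := Finset.single_le_sum (s := range n) (f := fun z : ℕ =>
    (1 / ((z : ℝ) + 1)) * (Nat.choose (n - 1) z : ℝ) * (1 - p) ^ z * p ^ (n - 1 - z))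
    (fun z _ => by positivity) (Finset.mem_range.2 hn)
  simpa [piB] using h

lemma piA_le_piB {n : ℕ} (hn : 1 ≤ n) (m : ℕ) (a b : ℝ) {p : ℝ} (hp0 : 0 < p) (hp1 : p < 1)
    (k : ℕ) : piA n m a b p k ≤ piB n p := by
  refine le_trans ?_ (pow_le_piB hn hp0 hp1)
  by_cases h : kStar m a b p ≤ k ∧ k ≤ m - 1
  · rw [piA_eq_geom_sum hp0 hp1 h.1 h.2]
    have hn' : (0 : ℝ) < n := by exact_mod_cast hn
    have hS := Scum_le_one hp0 hp1 h.2
    have hS' := (Sprev_lt_Scum hp0 hp1 h.2).le.trans hS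
    have hsum : ∑ i ∈ range n, Scum m p k ^ i * Sprev m p k ^ (n - 1 - i) ≤ n := by
      refine (Finset.sum_le_card_nsmul _ _ 1 fun i _ => ?_).trans_eq (by simp)
      exact mul_le_one₀ (pow_le_one₀ (Scum_nonneg m k hp0 hp1) hS)
        (pow_nonneg (Sprev_nonneg m k hp0 hp1) _)
        (pow_le_one₀ (Sprev_nonneg m k hp0 hp1) hS')
    rw [div_le_iff₀ hn']
    gcongr
  · rw [piA, if_neg h]
    positivity

/-- The utility of report `r` in terms of the number of underreported and overreported items. -/
lemma util_eq (n m : ℕ) (a b p : ℝ) (v r : Fin m → Bool) :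
    util n m a b p v r = (b - a) *
      ((univ.filter fun j => v j = true ∧ r j = false).card * piA n m a b p (kOf r)
        - (univ.filter fun j => v j = false ∧ r j = true).card * piB n p
        + ∑ τ ∈ range (kOf r), piA n m a b p τ) := by
  have hk : (kOf r : ℝ) = ∑ j, if r j = true then (1 : ℝ) else 0 := by
    simp [kOf]
  have hm : (m : ℝ) = ∑ _j : Fin m, (1 : ℝ) := by simp
  have hy : ((univ.filter fun j => v j = true ∧ r j = false).card : ℝ) =
      ∑ j, if v j = true ∧ r j = false then (1 : ℝ) else 0 := by simp
  have hx : ((univ.filter fun j => v j = false ∧ r j = true).card : ℝ) =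
      ∑ j, if v j = false ∧ r j = true then (1 : ℝ) else 0 := by simp
  have key : ∑ j, (if v j then b else a) * interim n m a b p r j =
      kOf r * b * piB n p + (m - kOf r) * a * piA n m a b p (kOf r) + (b - a) *
        ((univ.filter fun j => v j = true ∧ r j = false).card * piA n m a b p (kOf r)
          - (univ.filter fun j => v j = false ∧ r j = true).card * piB n p) := by
    unfold interim
    generalize piA n m a b p (kOf r) = A
    rw [hy, hx, hk, hm]
    simp only [← Finset.sum_sub_distrib, Finset.sum_mul, Finset.mul_sum,
      ← Finset.sum_add_distrib]
    refine Finset.sum_congr rfl fun j _ => ?_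
    cases v j <;> cases r j <;> simp <;> ring
  rw [util, key, pay]
  ring

lemma kOf_add_overreported {m : ℕ} (v r : Fin m → Bool) :
    kOf v + (univ.filter fun j => v j = false ∧ r j = true).card =
      kOf r + (univ.filter fun j => v j = true ∧ r j = false).card := by
  simp only [kOf, Finset.card_filter, ← Finset.sum_add_distrib]
  refine Finset.sum_congr rfl fun j _ => ?_
  cases v j <;> cases r j <;> simp

lemma kOf_add_overreported_le {m : ℕ} (v r : Fin m → Bool) :
    kOf v + (univ.filter fun j => v j = false ∧ r j = true).card ≤ m := by
  calc kOf v + (univ.filter fun j => v j = false ∧ r j = true).card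
      ≤ ∑ _j : Fin m, 1 := by
        simp only [kOf, Finset.card_filter, ← Finset.sum_add_distrib]
        refine Finset.sum_le_sum fun j _ => ?_
        cases v j <;> cases r j <;> simp
    _ = m := by simp

/-- The first-axis mechanism is Bayesian incentive compatible and individually rational,
and the truthful utility equals `(b−a)·∑_{τ=0}^{k_v−1} π(a,τ)`. -/
theorem firstAxis_BIC_IR (n m : ℕ) (hn : 1 ≤ n) (hm : 1 ≤ m)
    (a b p : ℝ) (ha : 0 < a) (hab : a < b) (hp0 : 0 < p) (hp1 : p < 1) :
    ∀ v r : Fin m → Bool,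
      util n m a b p v v ≥ util n m a b p v r ∧
      util n m a b p v v ≥ 0 ∧
      util n m a b p v v = (b - a) * ∑ τ ∈ Finset.range (kOf v), piA n m a b p τ := by
  intro v r
  have htruth : util n m a b p v v = (b - a) * ∑ τ ∈ range (kOf v), piA n m a b p τ := by
    simp [util_eq]
  refine ⟨?_, ?_, htruth⟩
  · rw [ge_iff_le, htruth, util_eq]
    refine mul_le_mul_of_nonneg_left ?_ (sub_pos.2 hab).le
    have hbal := kOf_add_overreported v r
    have hle := kOf_add_overreported_le v r
    generalize (univ.filter fun j => v j = false ∧ r j = true).card = x at *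
    generalize (univ.filter fun j => v j = true ∧ r j = false).card = y at *
    have hunder : y * piA n m a b p (kOf r) ≤ ∑ i ∈ range y, piA n m a b p (kOf r + i) := by
      have h := Finset.card_nsmul_le_sum (range y) (fun i => piA n m a b p (kOf r + i))
        (piA n m a b p (kOf r)) fun i hi => piA_le_piA n a b hp0 hp1 (by omega)
          (by have := Finset.mem_range.1 hi; omega)
      simpa using h
    have hover : ∑ i ∈ range x, piA n m a b p (kOf v + i) ≤ x * piB n p := by
      have h := Finset.sum_le_card_nsmul (range x) (fun i => piA n m a b p (kOf v + i))
        (piB n p) fun i _ => piA_le_piB hn m a b hp0 hp1 _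
      simpa using h
    have hsplit := Finset.sum_range_add (fun τ => piA n m a b p τ) (kOf v) x
    rw [hbal, Finset.sum_range_add] at hsplit
    linarith
  · rw [htruth]
    exact mul_nonneg (sub_pos.2 hab).le
      (Finset.sum_nonneg fun τ _ => piA_nonneg n m a b hp0 hp1 τ)
end
end

section
/- In the first-axis setting, the expected optimal revenue has the closed form: ∑ over profiles (v_1,…,v_n) ∈ ({a,b}^m)^n of (∏_{i=1}^{n} ∏_{j=1}^{m} w(v_{i,j})) · ∑_{j=1}^{m} max(0, max_{1≤i≤n} s_j(v_i)) = m·( b·(1−p^n) + p^n · ∑_{k=k*}^{m−1} (S_k^n − S_{k−1}^n) · f(k) ). -/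
/-!
Closed form for the expected optimal revenue in the first-axis setting
(`n` i.i.d. agents, `m` i.i.d. bi-valued items).  Valuations are modeled as
`Fin m → Bool` with `true` meaning the high value `b` and `false` the low value `a`.
-/

noncomputable section

open Finset

/-- The virtual value (hierarchy score) of item `j` under valuation `v`. -/
def score (m : ℕ) (a b p : ℝ) (v : Fin m → Bool) (j : Fin m) : ℝ :=
  if v j then b else fVal m a b p (kOf v)

/-- The probability weight of a single coordinate: `w(b) = 1−p`, `w(a) = p`. -/
def w (p : ℝ) (x : Bool) : ℝ := if x then 1 - p else p

/-- The binomial weight `C(m,z) (1-p)^z p^(m-z)`. -/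
def binomWeight (m : ℕ) (p : ℝ) (z : ℕ) : ℝ :=
  (Nat.choose m z : ℝ) * (1 - p) ^ z * p ^ (m - z)

lemma binomWeight_nonneg (m : ℕ) {p : ℝ} (hp0 : 0 < p) (hp1 : p < 1) (z : ℕ) :
    0 ≤ binomWeight m p z := by
  have : 0 < 1 - p := by linarith
  unfold binomWeight
  positivity

lemma binomWeight_pos {m : ℕ} {p : ℝ} (hp0 : 0 < p) (hp1 : p < 1) {z : ℕ} (hz : z ≤ m) :
    0 < binomWeight m p z := by
  have : 0 < 1 - p := by linarith
  have : 0 < Nat.choose m z := Nat.choose_pos hz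
  unfold binomWeight
  positivity

lemma binomWeight_succ {m z : ℕ} (p : ℝ) (hz : z < m) :
    p * ((z : ℝ) + 1) * binomWeight m p (z + 1) =
      (1 - p) * ((m : ℝ) - z) * binomWeight m p z := by
  have h : (Nat.choose m (z + 1) : ℝ) * ((z : ℝ) + 1) = Nat.choose m z * ((m : ℝ) - z) := by
    have := Nat.choose_succ_right_eq m z
    rw [← Nat.cast_sub hz.le]
    exact_mod_cast this
  have hpow : p ^ (m - z) = p * p ^ (m - (z + 1)) := by
    rw [← pow_succ']
    congr 1
    omega
  unfold binomWeight
  rw [hpow, pow_succ]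
  linear_combination p * (1 - p) ^ z * (1 - p) * p ^ (m - (z + 1)) * h

lemma fVal_eq (m : ℕ) (a b p : ℝ) (k : ℕ) :
    fVal m a b p k = a - (b - a) * ((∑ z ∈ Finset.Icc (k + 1) m, binomWeight m p z) /
      (((m : ℝ) - k) * binomWeight m p k)) := by
  unfold fVal binomWeight
  rw [mul_div_assoc]
  congr 3
  ring

lemma fVal_le (m : ℕ) {a b p : ℝ} (hab : a < b) (hp0 : 0 < p) (hp1 : p < 1) {k : ℕ}
    (hk : k < m) : fVal m a b p k ≤ a := by
  rw [fVal_eq]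
  have hk' : (0 : ℝ) < (m : ℝ) - k := by
    have : (k : ℝ) < m := by exact_mod_cast hk
    linarith
  have h1 : 0 ≤ ∑ z ∈ Finset.Icc (k + 1) m, binomWeight m p z :=
    Finset.sum_nonneg fun z _ => binomWeight_nonneg m hp0 hp1 z
  have h2 := binomWeight_nonneg m hp0 hp1 k
  have h3 : 0 < b - a := by linarith
  have : 0 ≤ (b - a) * ((∑ z ∈ Finset.Icc (k + 1) m, binomWeight m p z) /
      (((m : ℝ) - k) * binomWeight m p k)) := by positivity
  linarith

lemma fVal_le_succ (m : ℕ) {a b p : ℝ} (hab : a < b) (hp0 : 0 < p) (hp1 : p < 1) {k : ℕ}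
    (hk : k + 1 < m) : fVal m a b p k ≤ fVal m a b p (k + 1) := by
  rw [fVal_eq, fVal_eq]
  have hkm : (k : ℝ) + 1 < m := by exact_mod_cast hk
  have t0 := binomWeight_pos (m := m) hp0 hp1 (z := k) (by omega)
  have t1 := binomWeight_pos (m := m) hp0 hp1 (z := k + 1) (by omega)
  have hba : 0 ≤ b - a := by linarith
  refine sub_le_sub_left (mul_le_mul_of_nonneg_left ?_ hba) _
  have d0 : 0 < ((m : ℝ) - k) * binomWeight m p k := mul_pos (by linarith) t0
  have d1 : 0 < ((m : ℝ) - (k + 1 : ℕ)) * binomWeight m p (k + 1) :=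
    mul_pos (by push_cast; linarith) t1
  rw [div_le_div_iff₀ d1 d0]
  obtain ⟨r, rfl⟩ : ∃ r, m = r + 1 := ⟨m - 1, by omega⟩
  have hshift : ∑ z ∈ Finset.Icc (k + 1 + 1) (r + 1), binomWeight (r + 1) p z =
      ∑ z ∈ Finset.Icc (k + 1) r, binomWeight (r + 1) p (z + 1) := by
    rw [← Finset.image_add_right_Icc (k + 1) r 1, Finset.sum_image (by simp)]
  have hsub : ∑ z ∈ Finset.Icc (k + 1) r, binomWeight (r + 1) p z ≤
      ∑ z ∈ Finset.Icc (k + 1) (r + 1), binomWeight (r + 1) p z :=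
    Finset.sum_le_sum_of_subset_of_nonneg (Finset.Icc_subset_Icc_right (by omega))
      fun z _ _ => binomWeight_nonneg _ hp0 hp1 z
  refine le_trans ?_ (mul_le_mul_of_nonneg_right hsub d1.le)
  rw [hshift, Finset.sum_mul, Finset.sum_mul]
  refine Finset.sum_le_sum fun z hz => ?_
  rw [Finset.mem_Icc] at hz
  have hz1 : (k : ℝ) + 1 ≤ z := by exact_mod_cast hz.1
  have tz := binomWeight_pos (m := r + 1) hp0 hp1 (z := z) (by omega)
  have e1 := binomWeight_succ (m := r + 1) (z := z) p (by omega)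
  have e2 := binomWeight_succ (m := r + 1) (z := k) p (by omega)
  push_cast at *
  set M : ℝ := (r : ℝ) + 1
  set A := binomWeight (r + 1) p z
  set B := binomWeight (r + 1) p (z + 1)
  set C := binomWeight (r + 1) p k
  set D := binomWeight (r + 1) p (k + 1)
  have key : p * ((z : ℝ) + 1) * (B * ((M - k) * C)) =
      p * ((M - z) * ((k : ℝ) + 1)) * (A * D) := by
    linear_combination (M - k) * C * e1 - (M - z) * A * e2
  have hz0 : (0 : ℝ) < (z : ℝ) + 1 := by positivity
  have hcoef : (M - z) * ((k : ℝ) + 1) ≤ ((z : ℝ) + 1) * (M - (k + 1)) := by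
    have h1 : (M - z) * ((k : ℝ) + 1) ≤ (M - (k + 1)) * ((k : ℝ) + 1) :=
      mul_le_mul_of_nonneg_right (by linarith) (by positivity)
    have h2 : (M - (k + 1)) * ((k : ℝ) + 1) ≤ (M - (k + 1)) * ((z : ℝ) + 1) :=
      mul_le_mul_of_nonneg_left (by linarith) (by linarith)
    linarith
  have hAD : 0 ≤ p * (A * D) := by positivity
  have h3 := mul_le_mul_of_nonneg_right hcoef hAD
  refine le_of_mul_le_mul_left ?_ (mul_pos hp0 hz0)
  rw [key]
  linarith

lemma fVal_mono (m : ℕ) {a b p : ℝ} (hab : a < b) (hp0 : 0 < p) (hp1 : p < 1) {k l : ℕ}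
    (hkl : k ≤ l) (hl : l < m) : fVal m a b p k ≤ fVal m a b p l := by
  induction l, hkl using Nat.le_induction with
  | base => exact le_rfl
  | succ l _ ih => exact (ih (by omega)).trans (fVal_le_succ m hab hp0 hp1 hl)

lemma max_zero_fVal (m : ℕ) {a b p : ℝ} (hab : a < b) (hp0 : 0 < p) (hp1 : p < 1) {k : ℕ}
    (hk : k < m) :
    max 0 (fVal m a b p k) = if kStar m a b p ≤ k then fVal m a b p k else 0 := by
  classical
  unfold kStar
  split_ifs with h hle hle
  · have h1 := (Nat.find_spec h).2
    exact max_eq_right (h1.le.trans (fVal_mono m hab hp0 hp1 hle hk))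
  · have h1 := Nat.find_min h (not_le.mp hle)
    refine max_eq_left (not_lt.mp fun hpos => h1 ⟨by omega, hpos⟩)
  · omega
  · exact max_eq_left (not_lt.mp fun hpos => h ⟨k, by omega, hpos⟩)

/-- The indicator that item `j` has the low value in `v` and fewer than `k` items have
the high value. -/
def lowBelow {m : ℕ} (j : Fin m) (k : ℕ) (v : Fin m → Bool) : ℝ :=
  if v j = false ∧ kOf v < k then 1 else 0

lemma kOf_lt {m : ℕ} {v : Fin m → Bool} {j : Fin m} (h : v j = false) : kOf v < m := by
  have : kOf v < (Finset.univ : Finset (Fin m)).card :=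
    Finset.card_lt_card (Finset.ssubset_univ_iff.mpr fun hu => by
      have := hu ▸ Finset.mem_univ j
      simp [h] at this)
  simpa using this

lemma prod_w {m : ℕ} (p : ℝ) (v : Fin m → Bool) :
    ∏ j, w p (v j) = (1 - p) ^ kOf v * p ^ (m - kOf v) := by
  unfold w kOf
  rw [Finset.prod_ite, Finset.prod_const, Finset.prod_const]
  congr 2
  rw [Finset.filter_not, Finset.card_sdiff_of_subset (Finset.filter_subset _ _)]
  simp

lemma sum_prod_w (m : ℕ) (p : ℝ) : ∑ v : Fin m → Bool, ∏ j, w p (v j) = 1 := by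
  rw [← Fintype.sum_pow]
  simp [w]

lemma sum_prod_w_mul_lowBelow {m : ℕ} (p : ℝ) (j : Fin m) {k : ℕ} (hk : k ≤ m) :
    ∑ v : Fin m → Bool, (∏ l, w p (v l)) * lowBelow j k v =
      p * ∑ z ∈ Finset.range k, binomWeight (m - 1) p z := by
  classical
  have hm : 0 < m := j.pos
  have hcard : (Finset.univ.erase j).card = m - 1 := by simp
  calc ∑ v : Fin m → Bool, (∏ l, w p (v l)) * lowBelow j k v
      = ∑ v : Fin m → Bool with v j = false,
          if kOf v < k then (1 - p) ^ kOf v * p ^ (m - kOf v) else 0 := by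
        rw [Finset.sum_filter]
        refine Finset.sum_congr rfl fun v _ => ?_
        rw [prod_w, lowBelow]
        by_cases h1 : v j = false <;> by_cases h2 : kOf v < k <;> simp [h1, h2]
    _ = ∑ s ∈ (Finset.univ.erase j).powerset,
          if s.card < k then (1 - p) ^ s.card * p ^ (m - s.card) else 0 := by
        refine Finset.sum_bij' (fun v _ => Finset.univ.filter fun l => v l = true)
          (fun s _ l => decide (l ∈ s)) ?_ ?_ ?_ ?_ ?_
        · intro v hv
          simp only [Finset.mem_filter, Finset.mem_univ, true_and] at hv
          rw [Finset.mem_powerset]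
          intro l hl
          simp only [Finset.mem_filter, Finset.mem_univ, true_and] at hl
          refine Finset.mem_erase.mpr ⟨?_, Finset.mem_univ _⟩
          rintro rfl
          simp [hv] at hl
        · intro s hs
          rw [Finset.mem_powerset] at hs
          have : j ∉ s := fun h => by simpa using hs h
          simp [this]
        · intro v _
          ext l
          simp
        · intro s _
          ext l
          simp
        · intro v _
          rfl
    _ = ∑ z ∈ Finset.range m, if z < k then p * binomWeight (m - 1) p z else 0 := by
        rw [Finset.sum_powerset_apply_card
          (fun c => if c < k then (1 - p) ^ c * p ^ (m - c) else 0), hcard,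
          Nat.sub_add_cancel hm]
        refine Finset.sum_congr rfl fun z hz => ?_
        have hz := Finset.mem_range.mp hz
        split_ifs
        · rw [show m - z = (m - 1 - z) + 1 by omega, pow_succ, nsmul_eq_mul, binomWeight]
          ring
        · simp
    _ = p * ∑ z ∈ Finset.range k, binomWeight (m - 1) p z := by
        rw [← Finset.sum_filter, Finset.mul_sum]
        congr 1
        ext z
        simp only [Finset.mem_filter, Finset.mem_range]
        omega

lemma sum_binomWeight (m : ℕ) (hm : 1 ≤ m) (p : ℝ) :
    ∑ z ∈ Finset.range m, binomWeight (m - 1) p z = 1 := by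
  have h := add_pow (1 - p) p (m - 1)
  rw [sub_add_cancel, one_pow, Nat.sub_add_cancel hm] at h
  rw [h]
  refine Finset.sum_congr rfl fun z _ => ?_
  unfold binomWeight
  ring

lemma sum_profile_prod_lowBelow {m : ℕ} (n : ℕ) (p : ℝ) (j : Fin m) {k : ℕ} (hk : k ≤ m) :
    ∑ V : Fin n → Fin m → Bool,
        (∏ i, ∏ l, w p (V i l)) * ∏ i, lowBelow j k (V i) =
      p ^ n * (∑ z ∈ Finset.range k, binomWeight (m - 1) p z) ^ n := by
  simp_rw [← Finset.prod_mul_distrib]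
  rw [← mul_pow, ← sum_prod_w_mul_lowBelow p j hk, Fintype.sum_pow]

/-- The best nonnegative score of an item, expanded over the events that all agents have the
low value for it and that the largest number of high values of an agent is `k`. -/
lemma fold_score_eq {n m : ℕ} (hn : 1 ≤ n) {a b p : ℝ} (ha : 0 < a) (hab : a < b)
    (hp0 : 0 < p) (hp1 : p < 1) (V : Fin n → Fin m → Bool) (j : Fin m) :
    (Finset.univ.fold max (0 : ℝ) fun i : Fin n => score m a b p (V i) j) =
      b * (1 - ∏ i, lowBelow j m (V i)) +
        ∑ k ∈ Finset.range m, max 0 (fVal m a b p k) *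
          (∏ i, lowBelow j (k + 1) (V i) - ∏ i, lowBelow j k (V i)) := by
  by_cases h : ∃ i, V i j = true
  · obtain ⟨i₀, hi₀⟩ := h
    have hzero : ∀ k, ∏ i, lowBelow j k (V i) = 0 := fun k =>
      Finset.prod_eq_zero (Finset.mem_univ i₀) (by simp [lowBelow, hi₀])
    simp only [hzero, sub_zero, mul_one, mul_zero, Finset.sum_const_zero, add_zero]
    apply le_antisymm
    · rw [Finset.fold_max_le]
      refine ⟨by linarith, fun i _ => ?_⟩
      unfold score
      split_ifs with hi
      · exact le_rfl
      · exact (fVal_le m hab hp0 hp1 (kOf_lt (by simpa using hi))).trans hab.le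
    · rw [Finset.le_fold_max]
      exact Or.inr ⟨i₀, Finset.mem_univ _, by simp [score, hi₀]⟩
  · have hlow : ∀ i, V i j = false := by simpa using h
    have : Nonempty (Fin n) := ⟨⟨0, hn⟩⟩
    obtain ⟨i₀, hmax⟩ := Finite.exists_max fun i => kOf (V i)
    have hind : ∀ k, ∏ i, lowBelow j k (V i) = if kOf (V i₀) < k then 1 else 0 := by
      intro k
      split_ifs with hk
      · refine Finset.prod_eq_one fun i _ => ?_
        have := hmax i
        simp only [lowBelow, hlow i, true_and]
        rw [if_pos (by omega)]
      · exact Finset.prod_eq_zero (Finset.mem_univ i₀) (by simp [lowBelow, hk])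
    have hK := kOf_lt (hlow i₀)
    simp only [hind, if_pos hK, sub_self, mul_zero, zero_add]
    rw [Finset.sum_eq_single (kOf (V i₀))]
    · simp only [Nat.lt_succ_self, if_true, lt_irrefl, if_false, sub_zero, mul_one]
      apply le_antisymm
      · rw [Finset.fold_max_le]
        refine ⟨le_max_left _ _, fun i _ => le_max_of_le_right ?_⟩
        simpa [score, hlow i] using fVal_mono m hab hp0 hp1 (hmax i) hK
      · refine max_le ?_ ?_
        · rw [Finset.le_fold_max]
          exact Or.inl le_rfl
        · rw [Finset.le_fold_max]
          exact Or.inr ⟨i₀, Finset.mem_univ _, by simp [score, hlow i₀]⟩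
    · intro k _ hk
      by_cases hlt : kOf (V i₀) < k
      · simp [hlt, Nat.lt_succ_of_lt hlt]
      · have : ¬ kOf (V i₀) < k + 1 := by omega
        simp [hlt, this]
    · intro hnot
      exact absurd (Finset.mem_range.mpr hK) hnot

lemma Scum_eq (m : ℕ) (p : ℝ) (k : ℕ) :
    Scum m p k = ∑ z ∈ Finset.range (k + 1), binomWeight (m - 1) p z := rfl

lemma Sprev_eq (m : ℕ) (p : ℝ) (k : ℕ) :
    Sprev m p k = ∑ z ∈ Finset.range k, binomWeight (m - 1) p z := by
  cases k with
  | zero => simp [Sprev]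
  | succ k => simp [Sprev, Scum_eq]

/-- The expected revenue obtained from a single item. -/
lemma sum_profile_fold_score {n m : ℕ} (hn : 1 ≤ n) {a b p : ℝ} (ha : 0 < a) (hab : a < b)
    (hp0 : 0 < p) (hp1 : p < 1) (j : Fin m) :
    ∑ V : Fin n → Fin m → Bool, (∏ i, ∏ l, w p (V i l)) *
        (Finset.univ.fold max (0 : ℝ) fun i : Fin n => score m a b p (V i) j) =
      b * (1 - p ^ n) + p ^ n * ∑ k ∈ Finset.Icc (kStar m a b p) (m - 1),
        (Scum m p k ^ n - Sprev m p k ^ n) * fVal m a b p k := by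
  have hm : 1 ≤ m := j.pos
  have htotal : ∑ V : Fin n → Fin m → Bool, ∏ i, ∏ l, w p (V i l) = 1 := by
    have := Fintype.sum_pow (fun v : Fin m → Bool => ∏ l, w p (v l)) n
    rw [← this, sum_prod_w, one_pow]
  have hexpand : ∀ V : Fin n → Fin m → Bool, (∏ i, ∏ l, w p (V i l)) *
      (Finset.univ.fold max (0 : ℝ) fun i : Fin n => score m a b p (V i) j) =
      b * (∏ i, ∏ l, w p (V i l) - (∏ i, ∏ l, w p (V i l)) * ∏ i, lowBelow j m (V i)) +
        ∑ k ∈ Finset.range m, max 0 (fVal m a b p k) *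
          ((∏ i, ∏ l, w p (V i l)) * ∏ i, lowBelow j (k + 1) (V i) -
            (∏ i, ∏ l, w p (V i l)) * ∏ i, lowBelow j k (V i)) := by
    intro V
    rw [fold_score_eq hn ha hab hp0 hp1, mul_add, Finset.mul_sum]
    congr 1
    · ring
    · exact Finset.sum_congr rfl fun k _ => by ring
  simp_rw [hexpand]
  rw [Finset.sum_add_distrib, ← Finset.mul_sum, Finset.sum_sub_distrib, htotal,
    sum_profile_prod_lowBelow n p j le_rfl, sum_binomWeight m hm, one_pow, mul_one,
    Finset.sum_comm]
  congr 1
  have hIcc : Finset.Icc (kStar m a b p) (m - 1) =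
      (Finset.range m).filter fun k => kStar m a b p ≤ k := by
    ext k
    simp only [Finset.mem_Icc, Finset.mem_filter, Finset.mem_range]
    omega
  rw [hIcc, Finset.sum_filter, Finset.mul_sum]
  refine Finset.sum_congr rfl fun k hk => ?_
  have hk := Finset.mem_range.mp hk
  rw [← Finset.mul_sum, Finset.sum_sub_distrib, sum_profile_prod_lowBelow n p j hk,
    sum_profile_prod_lowBelow n p j hk.le, max_zero_fVal m hab hp0 hp1 hk, Scum_eq, Sprev_eq]
  split_ifs
  · ring
  · simp

/-- Closed form for the expected optimal revenue of the first-axis mechanism: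
the expectation (over i.i.d. profiles) of
`∑_j max(0, max_i s_j(v_i))` equals
`m·( b·(1−p^n) + p^n · ∑_{k=k*}^{m−1} (S_k^n − S_{k−1}^n) · f(k) )`. -/
theorem firstAxis_revenue (n m : ℕ) (hn : 1 ≤ n) (hm : 1 ≤ m)
    (a b p : ℝ) (ha : 0 < a) (hab : a < b) (hp0 : 0 < p) (hp1 : p < 1) :
    ∑ V : Fin n → Fin m → Bool,
        (∏ i : Fin n, ∏ j : Fin m, w p (V i j)) *
          ∑ j : Fin m, (Finset.univ.fold max (0 : ℝ) fun i : Fin n => score m a b p (V i) j)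
      = (m : ℝ) * (b * (1 - p ^ n) +
          p ^ n * ∑ k ∈ Finset.Icc (kStar m a b p) (m - 1),
            (Scum m p k ^ n - Sprev m p k ^ n) * fVal m a b p k) := by
  simp_rw [Finset.mul_sum]
  rw [Finset.sum_comm]
  simp_rw [← Finset.mul_sum]
  rw [Finset.sum_congr rfl fun j _ => sum_profile_fold_score hn ha hab hp0 hp1 j]
  rw [Finset.sum_const, Finset.card_univ, Fintype.card_fin, nsmul_eq_mul]
end
end

section
/- Under Variant I payments, the two-item mechanism is Bayesian individually rational (u(v,v) ≥ 0 for every type v ∈ {a,b}^2), and it is Bayesian incentive compatible (u(v,v) ≥ u(v,r) for all v, r ∈ {a,b}^2) if and only if all of the following hold: π₂ᵇᵇ ≥ π₂ᵇᵃ ≥ π₂ᵃᵃ; π₂ᵇᵃ + π₁ᵃᵃ ≥ π₁ᵃᵇ + π₂ᵃᵃ; π₁ᵇᵇ + π₂ᵃᵃ ≥ π₂ᵇᵃ + π₁ᵃᵃ; and π₁ᵇᵇ ≥ π₁ᵃᵃ. -/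
/-!
The two-item mechanism with six interim probabilities under Variant I payments.
A type/report is a pair `r : Bool × Bool`, where `true` means the high value `b`
and `false` the low value `a` for the corresponding item.
-/

noncomputable section

/-- Interim allocation probability for item 1 under report `r`. -/
def alloc1 (π1bb π1ab π1aa : ℝ) (r : Bool × Bool) : ℝ :=
  if r.1 then π1bb else if r.2 then π1ab else π1aa

/-- Interim allocation probability for item 2 under report `r`. -/
def alloc2 (π2bb π2ba π2aa : ℝ) (r : Bool × Bool) : ℝ :=
  if r.2 then π2bb else if r.1 then π2ba else π2aa

/-- Variant I interim payments. -/
def payI (a b π1bb π2bb π1ab π2ba π1aa π2aa : ℝ) (r : Bool × Bool) : ℝ :=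
  match r with
  | (true, true) => b * (π1bb + π2bb) - (b - a) * (π2ba + π1aa)
  | (true, false) => b * π1bb + a * π2ba - (b - a) * π1aa
  | (false, true) => a * π1ab + b * π2bb - (b - a) * π2aa
  | (false, false) => a * (π1aa + π2aa)

/-- Utility of true type `v` reporting `r` under Variant I payments. -/
def utilI (a b π1bb π2bb π1ab π2ba π1aa π2aa : ℝ) (v r : Bool × Bool) : ℝ :=
  (if v.1 then b else a) * alloc1 π1bb π1ab π1aa r +
  (if v.2 then b else a) * alloc2 π2bb π2ba π2aa r -
    payI a b π1bb π2bb π1ab π2ba π1aa π2aa r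

/-- Under Variant I payments the mechanism is Bayesian individually rational, and it is
Bayesian incentive compatible iff `π₂ᵇᵇ ≥ π₂ᵇᵃ ≥ π₂ᵃᵃ`,
`π₂ᵇᵃ + π₁ᵃᵃ ≥ π₁ᵃᵇ + π₂ᵃᵃ`, `π₁ᵇᵇ + π₂ᵃᵃ ≥ π₂ᵇᵃ + π₁ᵃᵃ`, and `π₁ᵇᵇ ≥ π₁ᵃᵃ`. -/
theorem variantI_BIR_and_BIC_iff (a b π1bb π2bb π1ab π2ba π1aa π2aa : ℝ) (hab : a < b)
    (h1 : 0 ≤ π1bb) (h2 : 0 ≤ π2bb) (h3 : 0 ≤ π1ab) (h4 : 0 ≤ π2ba)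
    (h5 : 0 ≤ π1aa) (h6 : 0 ≤ π2aa) :
    (∀ v : Bool × Bool, utilI a b π1bb π2bb π1ab π2ba π1aa π2aa v v ≥ 0) ∧
    ((∀ v r : Bool × Bool,
        utilI a b π1bb π2bb π1ab π2ba π1aa π2aa v v ≥
          utilI a b π1bb π2bb π1ab π2ba π1aa π2aa v r) ↔
      (π2bb ≥ π2ba ∧ π2ba ≥ π2aa ∧
        π2ba + π1aa ≥ π1ab + π2aa ∧
        π1bb + π2aa ≥ π2ba + π1aa ∧
        π1bb ≥ π1aa)) := by
  have hd : 0 < b - a := sub_pos.mpr hab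
  have cancel : ∀ {x : ℝ}, 0 ≤ (b - a) * x → 0 ≤ x := fun h => nonneg_of_mul_nonneg_right h hd
  constructor
  · rintro ⟨_ | _, _ | _⟩ <;> simp only [utilI, payI, alloc1, alloc2, if_true, if_false,
      Bool.false_eq_true]
    · linarith
    · linarith [mul_nonneg hd.le h6]
    · linarith [mul_nonneg hd.le h5]
    · linarith [mul_nonneg hd.le h4, mul_nonneg hd.le h5]
  constructor
  · intro h
    have e1 := h (true, false) (true, true)
    have e2 := h (true, true) (false, false)
    have e3 := h (true, true) (false, true)
    have e4 := h (false, true) (true, true)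
    have e5 := h (false, false) (true, false)
    simp only [utilI, payI, alloc1, alloc2, if_true, if_false, Bool.false_eq_true]
      at e1 e2 e3 e4 e5
    have i1 : 0 ≤ π2bb - π2ba := cancel (by linarith)
    have i2 : 0 ≤ π2ba - π2aa := cancel (by linarith)
    have i3 : 0 ≤ π2ba + π1aa - (π1ab + π2aa) := cancel (by linarith)
    have i4 : 0 ≤ π1bb + π2aa - (π2ba + π1aa) := cancel (by linarith)
    have i5 : 0 ≤ π1bb - π1aa := cancel (by linarith)
    refine ⟨?_, ?_, ?_, ?_, ?_⟩ <;> linarith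
  · rintro ⟨i1, i2, i3, i4, i5⟩
    have j1 := mul_le_mul_of_nonneg_left i1 hd.le
    have j2 := mul_le_mul_of_nonneg_left i2 hd.le
    have j3 := mul_le_mul_of_nonneg_left i3 hd.le
    have j4 := mul_le_mul_of_nonneg_left i4 hd.le
    have j5 := mul_le_mul_of_nonneg_left i5 hd.le
    rintro ⟨_ | _, _ | _⟩ ⟨_ | _, _ | _⟩ <;>
      simp only [utilI, payI, alloc1, alloc2, if_true, if_false, Bool.false_eq_true] <;>
      linarith
end
end

section
/- Under Variant II payments, the two-item mechanism is Bayesian individually rational (u(v,v) ≥ 0 for every type v ∈ {a,b}^2), and it is Bayesian incentive compatible (u(v,v) ≥ u(v,r) for all v, r ∈ {a,b}^2) if and only if all of the following hold: π₁ᵇᵇ ≥ π₁ᵃᵇ ≥ π₁ᵃᵃ; π₁ᵃᵇ + π₂ᵃᵃ ≥ π₂ᵇᵃ + π₁ᵃᵃ; π₂ᵇᵇ + π₁ᵃᵃ ≥ π₁ᵃᵇ + π₂ᵃᵃ; and π₂ᵇᵇ ≥ π₂ᵃᵃ. -/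
/-!
The two-item mechanism with six interim probabilities under Variant II payments.
A type/report is a pair `r : Bool × Bool`, where `true` means the high value `b`
and `false` the low value `a` for the corresponding item.
-/

noncomputable section

/-- Variant II interim payments. -/
def payII (a b π1bb π2bb π1ab π2ba π1aa π2aa : ℝ) (r : Bool × Bool) : ℝ :=
  match r with
  | (true, true) => b * (π1bb + π2bb) - (b - a) * (π1ab + π2aa)
  | (true, false) => b * π1bb + a * π2ba - (b - a) * π1aa
  | (false, true) => a * π1ab + b * π2bb - (b - a) * π2aa
  | (false, false) => a * (π1aa + π2aa)

/-- Utility of true type `v` reporting `r` under Variant II payments. -/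
def utilII (a b π1bb π2bb π1ab π2ba π1aa π2aa : ℝ) (v r : Bool × Bool) : ℝ :=
  (if v.1 then b else a) * alloc1 π1bb π1ab π1aa r +
  (if v.2 then b else a) * alloc2 π2bb π2ba π2aa r -
    payII a b π1bb π2bb π1ab π2ba π1aa π2aa r

/-- Under Variant II payments the mechanism is Bayesian individually rational, and it is
Bayesian incentive compatible iff `π₁ᵇᵇ ≥ π₁ᵃᵇ ≥ π₁ᵃᵃ`,
`π₁ᵃᵇ + π₂ᵃᵃ ≥ π₂ᵇᵃ + π₁ᵃᵃ`, `π₂ᵇᵇ + π₁ᵃᵃ ≥ π₁ᵃᵇ + π₂ᵃᵃ`, and `π₂ᵇᵇ ≥ π₂ᵃᵃ`. -/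
theorem variantII_BIR_and_BIC_iff (a b π1bb π2bb π1ab π2ba π1aa π2aa : ℝ) (hab : a < b)
    (h1 : 0 ≤ π1bb) (h2 : 0 ≤ π2bb) (h3 : 0 ≤ π1ab) (h4 : 0 ≤ π2ba)
    (h5 : 0 ≤ π1aa) (h6 : 0 ≤ π2aa) :
    (∀ v : Bool × Bool, utilII a b π1bb π2bb π1ab π2ba π1aa π2aa v v ≥ 0) ∧
    ((∀ v r : Bool × Bool,
        utilII a b π1bb π2bb π1ab π2ba π1aa π2aa v v ≥
          utilII a b π1bb π2bb π1ab π2ba π1aa π2aa v r) ↔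
      (π1bb ≥ π1ab ∧ π1ab ≥ π1aa ∧
        π1ab + π2aa ≥ π2ba + π1aa ∧
        π2bb + π1aa ≥ π1ab + π2aa ∧
        π2bb ≥ π2aa)) := by
  have hd : 0 < b - a := sub_pos.mpr hab
  refine ⟨?_, ?_, ?_⟩
  · have m3 := mul_nonneg hd.le h3
    have m5 := mul_nonneg hd.le h5
    have m6 := mul_nonneg hd.le h6
    rintro ⟨_ | _, _ | _⟩ <;> simp [utilII, alloc1, alloc2, payII] <;> linarith
  · intro h
    have e1 := h (false, true) (true, true)
    have e2 := h (true, true) (false, false)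
    have e3 := h (true, true) (true, false)
    have e4 := h (true, false) (true, true)
    have e5 := h (false, false) (false, true)
    simp only [utilII, alloc1, alloc2, payII, if_true, Bool.false_eq_true, if_false]
      at e1 e2 e3 e4 e5
    refine ⟨?_, ?_, ?_, ?_, ?_⟩ <;> refine le_of_mul_le_mul_left ?_ hd <;> linarith
  · rintro ⟨c1, c2, c3, c4, c5⟩
    have m1 := mul_le_mul_of_nonneg_left c1 hd.le
    have m2 := mul_le_mul_of_nonneg_left c2 hd.le
    have m3 := mul_le_mul_of_nonneg_left c3 hd.le
    have m4 := mul_le_mul_of_nonneg_left c4 hd.le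
    have m5 := mul_le_mul_of_nonneg_left c5 hd.le
    rintro ⟨_ | _, _ | _⟩ ⟨_ | _, _ | _⟩ <;>
      simp only [utilII, alloc1, alloc2, payII, if_true, Bool.false_eq_true, if_false] <;>
      linarith
end
end

section
/- Let n ≥ 1 be an integer and let 0 ≤ q ≤ p < 1 be reals. Define π₁ᵇᵇ = (1−p^n)/(n(1−p)), π₂ᵇᵇ = (1−q^n)/(n(1−q)), π₁ᵃᵇ = p^{n−1}·(1−q^n)/(n(1−q)), π₂ᵇᵃ = q^{n−1}·(1−p^n)/(n(1−p)), and π₁ᵃᵃ = π₂ᵃᵃ = (pq)^{n−1}/n. Then: π₁ᵇᵇ ≥ π₂ᵇᵇ; π₁ᵃᵇ ≥ π₂ᵇᵃ; π₁ᵇᵇ ≥ π₁ᵃᵇ ≥ π₁ᵃᵃ; and π₂ᵇᵇ ≥ π₂ᵇᵃ ≥ π₂ᵃᵃ. -/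
/-- The closed form of a scaled truncated geometric series. -/
theorem mul_one_sub_pow_div_eq_geom_sum (n : ℕ) (c x : ℝ) (hx : x < 1) :
    c * (1 - x ^ n) / ((n : ℝ) * (1 - x)) = c * (∑ i ∈ Finset.range n, x ^ i) / n := by
  have hx' : 1 - x ≠ 0 := (sub_pos.2 hx).ne'
  rw [← mul_neg_geom_sum x n, mul_left_comm, mul_comm (n : ℝ), mul_div_mul_left _ _ hx']

theorem pow_mul_pow_le_pow_mul_pow {p q : ℝ} (hq : 0 ≤ q) (hqp : q ≤ p) {i m : ℕ} (him : i ≤ m) :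
    q ^ m * p ^ i ≤ p ^ m * q ^ i := by
  have hp : 0 ≤ p := hq.trans hqp
  obtain ⟨k, rfl⟩ := Nat.exists_eq_add_of_le him
  calc q ^ (i + k) * p ^ i = (p ^ i * q ^ i) * q ^ k := by ring
    _ ≤ (p ^ i * q ^ i) * p ^ k := by gcongr
    _ = p ^ (i + k) * q ^ i := by ring

/-- Monotonicity of the interim allocation probabilities of the hierarchy-allocation
mechanism for `n` i.i.d. agents and two items, with `0 ≤ q ≤ p < 1`:
`π₁ᵇᵇ ≥ π₂ᵇᵇ`, `π₁ᵃᵇ ≥ π₂ᵇᵃ`, `π₁ᵇᵇ ≥ π₁ᵃᵇ ≥ π₁ᵃᵃ`, and `π₂ᵇᵇ ≥ π₂ᵇᵃ ≥ π₂ᵃᵃ`, where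
`π₁ᵇᵇ = (1−p^n)/(n(1−p))`, `π₂ᵇᵇ = (1−q^n)/(n(1−q))`,
`π₁ᵃᵇ = p^{n−1}(1−q^n)/(n(1−q))`, `π₂ᵇᵃ = q^{n−1}(1−p^n)/(n(1−p))`, and
`π₁ᵃᵃ = π₂ᵃᵃ = (pq)^{n−1}/n`. -/
theorem interim_probabilities_monotone (n : ℕ) (hn : 1 ≤ n)
    (p q : ℝ) (hq0 : 0 ≤ q) (hqp : q ≤ p) (hp1 : p < 1) :
    ((1 - p ^ n) / ((n : ℝ) * (1 - p)) ≥ (1 - q ^ n) / ((n : ℝ) * (1 - q))) ∧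
    (p ^ (n - 1) * (1 - q ^ n) / ((n : ℝ) * (1 - q)) ≥
      q ^ (n - 1) * (1 - p ^ n) / ((n : ℝ) * (1 - p))) ∧
    ((1 - p ^ n) / ((n : ℝ) * (1 - p)) ≥ p ^ (n - 1) * (1 - q ^ n) / ((n : ℝ) * (1 - q)) ∧
      p ^ (n - 1) * (1 - q ^ n) / ((n : ℝ) * (1 - q)) ≥ (p * q) ^ (n - 1) / (n : ℝ)) ∧
    ((1 - q ^ n) / ((n : ℝ) * (1 - q)) ≥ q ^ (n - 1) * (1 - p ^ n) / ((n : ℝ) * (1 - p)) ∧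
      q ^ (n - 1) * (1 - p ^ n) / ((n : ℝ) * (1 - p)) ≥ (p * q) ^ (n - 1) / (n : ℝ)) := by
  have hp0 : 0 ≤ p := hq0.trans hqp
  have hq1 : q < 1 := hqp.trans_lt hp1
  have hb (x : ℝ) (hx : x < 1) :
      (1 - x ^ n) / ((n : ℝ) * (1 - x)) = (∑ i ∈ Finset.range n, x ^ i) / n := by
    simpa using mul_one_sub_pow_div_eq_geom_sum n 1 x hx
  have hsum : ∑ i ∈ Finset.range n, q ^ i ≤ ∑ i ∈ Finset.range n, p ^ i := by gcongr
  have hlast (x : ℝ) (hx : 0 ≤ x) : x ^ (n - 1) ≤ ∑ i ∈ Finset.range n, x ^ i :=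
    Finset.single_le_sum (f := fun i ↦ x ^ i) (fun i _ ↦ pow_nonneg hx i)
      (Finset.mem_range.2 (by omega))
  rw [hb p hp1, hb q hq1, mul_one_sub_pow_div_eq_geom_sum n _ q hq1,
    mul_one_sub_pow_div_eq_geom_sum n _ p hp1, mul_pow]
  refine ⟨?_, ?_, ⟨?_, ?_⟩, ?_, ?_⟩ <;> refine div_le_div_of_nonneg_right ?_ n.cast_nonneg
  · exact hsum
  · rw [Finset.mul_sum, Finset.mul_sum]
    refine Finset.sum_le_sum fun i hi ↦ pow_mul_pow_le_pow_mul_pow hq0 hqp ?_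
    have := Finset.mem_range.1 hi
    omega
  · exact (mul_le_of_le_one_left (Finset.sum_nonneg fun i _ ↦ pow_nonneg hq0 i)
      (pow_le_one₀ hp0 hp1.le)).trans hsum
  · exact mul_le_mul_of_nonneg_left (hlast q hq0) (pow_nonneg hp0 _)
  · rw [Finset.mul_sum]
    refine Finset.sum_le_sum fun i hi ↦ ?_
    have := Finset.mem_range.1 hi
    exact (mul_le_of_le_one_right (pow_nonneg hq0 _) (pow_le_one₀ hp0 hp1.le)).trans
      (pow_le_pow_of_le_one hq0 hq1.le (by omega))
  · rw [mul_comm (p ^ (n - 1))]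
    exact mul_le_mul_of_nonneg_left (hlast p hp0) (pow_nonneg hq0 _)
end

section
/- The per-agent expected revenue computed with the flow-induced (starred) probabilities equals the per-agent expected revenue computed with the Region-6 (modified) probabilities: Rev(π^{(*)}) = Rev(π^{(6)}). Equivalently, the difference equals (b−a−pb)·((1−q)(π₁ᵃᵇ⁽⁶⁾ − π₁ᵃᵇ⁽*⁾) + q(π₁ᵃᵃ⁽⁶⁾ − π₁ᵃᵃ⁽*⁾)), and the second factor is zero. -/
noncomputable section

/-- Per-agent expected revenue of the two-item mechanism with interim probabilities
`π1bb, π2bb, π1ab, π2ba, π1aa, π2aa`, with the `(b,b)` payment in its Variant II form. -/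
def Rev (a b p q π1bb π2bb π1ab π2ba π1aa π2aa : ℝ) : ℝ :=
  (1 - p) * (1 - q) * (b * (π1bb + π2bb) - (b - a) * (π1ab + π2aa))
  + (1 - p) * q * (b * π1bb + a * π2ba - (b - a) * π1aa)
  + p * (1 - q) * (a * π1ab + b * π2bb - (b - a) * π2aa)
  + p * q * (a * (π1aa + π2aa))

/-- The per-agent expected revenue computed with the flow-induced (starred) probabilities
equals the per-agent expected revenue computed with the Region-6 probabilities;
the difference equals `(b−a−pb)·((1−q)(π₁ᵃᵇ⁽⁶⁾−π₁ᵃᵇ⁽*⁾)+q(π₁ᵃᵃ⁽⁶⁾−π₁ᵃᵃ⁽*⁾))`,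
whose second factor is zero. -/
theorem region6_revenue_eq (n : ℕ) (hn : 1 ≤ n) (a b p q : ℝ)
    (hp0 : 0 < p) (hp1 : p < 1) (hq0 : 0 < q) (hq1 : q < 1) :
    let π1bb : ℝ := (1 - p ^ n) / ((n : ℝ) * (1 - p))
    let π2bb : ℝ := (1 - q ^ n) / ((n : ℝ) * (1 - q))
    let π2ba : ℝ := q ^ (n - 1) * (1 - p ^ n) / ((n : ℝ) * (1 - p))
    let π1abStar : ℝ := p ^ (n - 1) / (n : ℝ)
    let π1aaStar : ℝ := p ^ (n - 1) / (n : ℝ)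
    let π1ab6 : ℝ := p ^ (n - 1) * (1 - q ^ n) / ((n : ℝ) * (1 - q))
    let π1aa6 : ℝ := (p * q) ^ (n - 1) / (n : ℝ)
    Rev a b p q π1bb π2bb π1abStar π2ba π1aaStar 0 =
      Rev a b p q π1bb π2bb π1ab6 π2ba π1aa6 0 ∧
    Rev a b p q π1bb π2bb π1abStar π2ba π1aaStar 0 -
        Rev a b p q π1bb π2bb π1ab6 π2ba π1aa6 0 =
      (b - a - p * b) * ((1 - q) * (π1ab6 - π1abStar) + q * (π1aa6 - π1aaStar)) ∧
    (1 - q) * (π1ab6 - π1abStar) + q * (π1aa6 - π1aaStar) = 0 := by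
  intro π1bb π2bb π2ba π1abStar π1aaStar π1ab6 π1aa6
  have factor_zero : (1 - q) * (π1ab6 - π1abStar) + q * (π1aa6 - π1aaStar) = 0 := by
    obtain ⟨m, rfl⟩ := Nat.exists_eq_add_of_le' hn
    have hq : 1 - q ≠ 0 := (sub_pos.mpr hq1).ne'
    have hm : ((m + 1 : ℕ) : ℝ) ≠ 0 := Nat.cast_ne_zero.mpr m.succ_ne_zero
    simp only [π1ab6, π1abStar, π1aa6, π1aaStar, Nat.add_sub_cancel, mul_pow]
    field_simp
    ring
  have difference : Rev a b p q π1bb π2bb π1abStar π2ba π1aaStar 0 -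
        Rev a b p q π1bb π2bb π1ab6 π2ba π1aa6 0 =
      (b - a - p * b) * ((1 - q) * (π1ab6 - π1abStar) + q * (π1aa6 - π1aaStar)) := by
    unfold Rev
    ring
  refine ⟨sub_eq_zero.mp ?_, difference, factor_zero⟩
  rw [difference, factor_zero, mul_zero]
end
end
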